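/- arXiv:1309.5884 — 2 statements merged into one kernel-verified Lean document; each statement's English description precedes it below -/
import Mathlib

section
/- Under the backward-backward setup with summable errors, if Φ is bounded below on X × X, then Σ_{n=0}^∞ d(x_{n+1}, x_n)² < +∞ and Σ_{n=0}^∞ d(y_{n+1}, y_n)² < +∞. -/
open Set Filter Topology

/-- The objective `Φ(x,y) = f(x) + g(y) + (1/(2γ)) d(x,y)²` of the backward-backward
splitting problem (with `t` playing the role of `γ > 0`). -/
noncomputable def Phi {X : Type*} [MetricSpace X] (f g : X → EReal) (t : ℝ)
    (x y : X) : EReal :=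
  f x + g y + (((1 / (2 * t)) * dist x y ^ 2 : ℝ) : EReal)

/-- A sequence which decreases up to summable errors and is bounded below has summable
decrements. -/
lemma summable_of_add_le_add {W a b : ℕ → ℝ} {M : ℝ} (ha : ∀ n, 0 ≤ a n) (hb : ∀ n, 0 ≤ b n)
    (hbs : Summable b) (hM : ∀ n, M ≤ W n) (h : ∀ n, W (n + 1) + a n ≤ W n + b n) :
    Summable a := by
  have key : ∀ n, W n + ∑ i ∈ Finset.range n, a i ≤ W 0 + ∑ i ∈ Finset.range n, b i := by
    intro n
    induction n with
    | zero => simp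
    | succ n ih =>
      rw [Finset.sum_range_succ, Finset.sum_range_succ]
      linarith [h n]
  refine summable_of_sum_range_le (c := W 0 - M + ∑' i, b i) ha fun n => ?_
  linarith [key n, hM n, hbs.sum_le_tsum (Finset.range n) fun i _ => hb i]

lemma Summable.sq_of_nonneg {a : ℕ → ℝ} (ha : ∀ n, 0 ≤ a n) (hs : Summable a) :
    Summable fun n => a n ^ 2 := by
  refine summable_of_sum_range_le (c := (∑' i, a i) ^ 2) (fun n => sq_nonneg _) fun n => ?_
  calc ∑ i ∈ Finset.range n, a i ^ 2 ≤ (∑ i ∈ Finset.range n, a i) ^ 2 :=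
        Finset.sum_sq_le_sq_sum_of_nonneg fun i _ => ha i
    _ ≤ (∑' i, a i) ^ 2 :=
        pow_le_pow_left₀ (Finset.sum_nonneg fun i _ => ha i)
          (hs.sum_le_tsum _ fun i _ => ha i) 2

/-- Square-summability of the steps is stable under perturbations with summable size. -/
lemma summable_step_sq_of_close {X : Type*} [MetricSpace X] {x v : ℕ → X}
    (hx : Summable fun n => dist (x n) (v n) ^ 2)
    (hv : Summable fun n => dist (v (n + 1)) (v n) ^ 2) :
    Summable fun n => dist (x (n + 1)) (x n) ^ 2 := by
  have hx' := (summable_nat_add_iff 1).2 hx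
  refine Summable.of_nonneg_of_le (fun n => sq_nonneg _) (fun n => ?_)
    (((hx'.add hv).add hx).mul_left 3)
  have h := dist_triangle4 (x (n + 1)) (v (n + 1)) (v n) (x n)
  rw [dist_comm (v n) (x n)] at h
  calc dist (x (n + 1)) (x n) ^ 2
      ≤ (dist (x (n + 1)) (v (n + 1)) + dist (v (n + 1)) (v n) + dist (x n) (v n)) ^ 2 :=
        pow_le_pow_left₀ dist_nonneg h 2
    _ ≤ _ := by
        nlinarith [sq_nonneg (dist (x (n + 1)) (v (n + 1)) - dist (v (n + 1)) (v n)),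
          sq_nonneg (dist (x (n + 1)) (v (n + 1)) - dist (x n) (v n)),
          sq_nonneg (dist (v (n + 1)) (v n) - dist (x n) (v n))]

section Hadamard

variable {X : Type*} [MetricSpace X] {G : X → X → ℝ → X}

/-- The quadrilateral inequality in an Hadamard space. -/
lemma hadamard_quadrilateral
    (hcmp : ∀ x y z : X, ∀ l ∈ Icc (0:ℝ) 1,
      dist z (G x y l) ^ 2 ≤ (1 - l) * dist z x ^ 2 + l * dist z y ^ 2
        - l * (1 - l) * dist x y ^ 2) (a b c d : X) :
    dist a c ^ 2 + dist b d ^ 2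
      ≤ dist b a ^ 2 + dist b c ^ 2 + dist d a ^ 2 + dist d c ^ 2 := by
  have hb := hcmp a c b (1 / 2) ⟨by norm_num, by norm_num⟩
  have hd := hcmp a c d (1 / 2) ⟨by norm_num, by norm_num⟩
  have h := pow_le_pow_left₀ dist_nonneg (dist_triangle_right b d (G a c (1 / 2))) 2
  nlinarith [sq_nonneg (dist b (G a c (1 / 2)) - dist d (G a c (1 / 2)))]

/-- A Cauchy–Schwarz type inequality for the quasilinearization of an Hadamard space. -/
lemma hadamard_quasilinearization_le
    (hcmp : ∀ x y z : X, ∀ l ∈ Icc (0:ℝ) 1,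
      dist z (G x y l) ^ 2 ≤ (1 - l) * dist z x ^ 2 + l * dist z y ^ 2
        - l * (1 - l) * dist x y ^ 2) (a b c d : X) :
    dist a d ^ 2 + dist b c ^ 2 - dist a c ^ 2 - dist b d ^ 2
      ≤ 2 * dist a b ^ 2 + dist c d ^ 2 / 2 := by
  have hc := hcmp c d c (1 / 2) ⟨by norm_num, by norm_num⟩
  have hd := hcmp c d d (1 / 2) ⟨by norm_num, by norm_num⟩
  have h₁ := hadamard_quadrilateral hcmp a c (G c d (1 / 2)) b
  have h₂ := hadamard_quadrilateral hcmp a (G c d (1 / 2)) d b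
  rw [dist_self] at hc hd
  simp only [dist_comm c a, dist_comm b a, dist_comm d c, dist_comm c b,
    dist_comm (G c d (1 / 2)) a, dist_comm (G c d (1 / 2)) d,
    dist_comm (G c d (1 / 2)) b] at *
  linarith

lemma prox_ne_top {f : X → EReal} {t : ℝ} (ht : 0 < t) (hproper : ∃ z, f z ≠ ⊤) {a p : X}
    (hp : ∀ z : X, ((t : ℝ) : EReal) * f p + (((1/2) * dist a p ^ 2 : ℝ) : EReal)
        ≤ ((t : ℝ) : EReal) * f z + (((1/2) * dist a z ^ 2 : ℝ) : EReal)) :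
    f p ≠ ⊤ := by
  obtain ⟨z, hz⟩ := hproper
  intro htop
  have h := hp z
  rw [htop, EReal.coe_mul_top_of_pos ht, EReal.top_add_coe, top_le_iff] at h
  induction hfz : f z with
  | bot => simp [hfz, EReal.coe_mul_bot_of_pos ht] at h
  | top => exact hz hfz
  | coe r =>
    rw [hfz] at h
    norm_cast at h
    exact EReal.coe_ne_top _ h

/-- The strong form of the minimality of a proximal point. -/
lemma prox_variational_inequality
    (hcmp : ∀ x y z : X, ∀ l ∈ Icc (0:ℝ) 1,
      dist z (G x y l) ^ 2 ≤ (1 - l) * dist z x ^ 2 + l * dist z y ^ 2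
        - l * (1 - l) * dist x y ^ 2)
    {f : X → EReal} (hbot : ∀ a, f a ≠ ⊥)
    (hconv : ∀ a b : X, ∀ l ∈ Icc (0:ℝ) 1,
      f (G a b l) ≤ ((1 - l : ℝ) : EReal) * f a + ((l : ℝ) : EReal) * f b)
    {t : ℝ} (ht : 0 < t) {a p z : X}
    (hp : ∀ z : X, ((t : ℝ) : EReal) * f p + (((1/2) * dist a p ^ 2 : ℝ) : EReal)
        ≤ ((t : ℝ) : EReal) * f z + (((1/2) * dist a z ^ 2 : ℝ) : EReal))
    (hz : f z ≠ ⊤) :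
    t * (f p).toReal + dist a p ^ 2 / 2 + dist p z ^ 2 / 2
      ≤ t * (f z).toReal + dist a z ^ 2 / 2 := by
  have hpt : f p ≠ ⊤ := prox_ne_top ht ⟨z, hz⟩ hp
  lift f z to ℝ using ⟨hz, hbot z⟩ with r hr
  lift f p to ℝ using ⟨hpt, hbot p⟩ with q hq
  simp only [EReal.toReal_coe]
  have key : ∀ l ∈ Ioc (0:ℝ) 1,
      t * q + dist a p ^ 2 / 2 + (1 - l) * (dist p z ^ 2 / 2) ≤ t * r + dist a z ^ 2 / 2 := by
    intro l hl
    have hl' : l ∈ Icc (0:ℝ) 1 := ⟨hl.1.le, hl.2⟩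
    have h₁ := hconv p z l hl'
    have h₂ := hp (G p z l)
    have h₃ := hcmp p z a l hl'
    rw [← hr, ← hq] at h₁
    norm_cast at h₁
    have hGt : f (G p z l) ≠ ⊤ := ne_top_of_le_ne_top (EReal.coe_ne_top _) h₁
    lift f (G p z l) to ℝ using ⟨hGt, hbot _⟩ with s hs
    norm_cast at h₁ h₂
    have h₄ := mul_le_mul_of_nonneg_left h₁ ht.le
    refine le_of_mul_le_mul_left ?_ hl.1
    nlinarith
  have hlim : Tendsto (fun l : ℝ => t * q + dist a p ^ 2 / 2 + (1 - l) * (dist p z ^ 2 / 2))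
      (𝓝[>] 0) (𝓝 (t * q + dist a p ^ 2 / 2 + (1 - 0) * (dist p z ^ 2 / 2))) := by
    apply Tendsto.mono_left _ nhdsWithin_le_nhds
    exact Continuous.tendsto (by fun_prop) 0
  rw [sub_zero, one_mul] at hlim
  refine le_of_tendsto hlim ?_
  filter_upwards [Ioc_mem_nhdsGT (zero_lt_one (α := ℝ))] with l hl using key l hl

end Hadamard

/-- Backward-backward setup with summable errors: if `Φ` is bounded
below on `X × X`, then `Σ d(x_{n+1},x_n)² < ∞` and `Σ d(y_{n+1},y_n)² < ∞`. -/
theorem bb_summable_steps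
    {X : Type*} [MetricSpace X] [CompleteSpace X]
    (G : X → X → ℝ → X)
    (hG0 : ∀ x y, G x y 0 = x) (hG1 : ∀ x y, G x y 1 = y)
    (hGd : ∀ x y, ∀ s ∈ Icc (0:ℝ) 1, ∀ u ∈ Icc (0:ℝ) 1,
      dist (G x y s) (G x y u) = |s - u| * dist x y)
    (hcmp : ∀ x y z : X, ∀ l ∈ Icc (0:ℝ) 1,
      dist z (G x y l) ^ 2 ≤ (1 - l) * dist z x ^ 2 + l * dist z y ^ 2
        - l * (1 - l) * dist x y ^ 2)
    (f g : X → EReal)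
    (hfproper : ∃ a, f a ≠ ⊤) (hfbot : ∀ a, f a ≠ ⊥)
    (hfconv : ∀ a b : X, ∀ l ∈ Icc (0:ℝ) 1,
      f (G a b l) ≤ ((1 - l : ℝ) : EReal) * f a + ((l : ℝ) : EReal) * f b)
    (hflsc : LowerSemicontinuous f)
    (hgproper : ∃ a, g a ≠ ⊤) (hgbot : ∀ a, g a ≠ ⊥)
    (hgconv : ∀ a b : X, ∀ l ∈ Icc (0:ℝ) 1,
      g (G a b l) ≤ ((1 - l : ℝ) : EReal) * g a + ((l : ℝ) : EReal) * g b)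
    (hglsc : LowerSemicontinuous g)
    (t : ℝ) (ht : 0 < t)
    -- `proxf x = Prox_{t·f}(x)` and `proxg x = Prox_{t·g}(x)`:
    (proxf proxg : X → X)
    (hproxf : ∀ a z : X,
      ((t : ℝ) : EReal) * f (proxf a) + (((1/2) * dist a (proxf a) ^ 2 : ℝ) : EReal)
        ≤ ((t : ℝ) : EReal) * f z + (((1/2) * dist a z ^ 2 : ℝ) : EReal))
    (hproxg : ∀ a z : X,
      ((t : ℝ) : EReal) * g (proxg a) + (((1/2) * dist a (proxg a) ^ 2 : ℝ) : EReal)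
        ≤ ((t : ℝ) : EReal) * g z + (((1/2) * dist a z ^ 2 : ℝ) : EReal))
    (x y : ℕ → X)
    (herr₁ : Summable (fun n => dist (y n) (proxg (x n))))
    (herr₂ : Summable (fun n => dist (x (n + 1)) (proxf (y n))))
    (hbdd : ∃ M : ℝ, ∀ a b : X, ((M : ℝ) : EReal) ≤ Phi f g t a b) :
    Summable (fun n => dist (x (n + 1)) (x n) ^ 2) ∧
    Summable (fun n => dist (y (n + 1)) (y n) ^ 2) := by
  obtain ⟨M, hM⟩ := hbdd
  obtain ⟨v, hv⟩ : ∃ v : ℕ → X, ∀ n, proxf (y n) = v n := ⟨_, fun _ => rfl⟩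
  obtain ⟨u, hu⟩ : ∃ u : ℕ → X, ∀ n, proxg (x (n + 1)) = u n := ⟨_, fun _ => rfl⟩
  have hpv := fun n => hproxf (y n)
  have hpu := fun n => hproxg (x (n + 1))
  have herr₁' := (summable_nat_add_iff 1).2 herr₁
  simp only [hv] at hpv herr₂
  simp only [hu] at hpu herr₁'
  have hfv : ∀ n, f (v n) ≠ ⊤ := fun n => prox_ne_top ht hfproper (hpv n)
  have hgu : ∀ n, g (u n) ≠ ⊤ := fun n => prox_ne_top ht hgproper (hpu n)
  have hxv : Summable fun n => dist (x (n + 1)) (v n) ^ 2 :=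
    herr₂.sq_of_nonneg fun _ => dist_nonneg
  have hyu : Summable fun n => dist (y (n + 1)) (u n) ^ 2 :=
    herr₁'.sq_of_nonneg fun _ => dist_nonneg
  have hsum : Summable fun n =>
      (dist (v (n + 1)) (v n) ^ 2 + dist (u (n + 1)) (u n) ^ 2) / 4 := by
    refine summable_of_add_le_add (M := t * M)
      (W := fun n => t * (f (v n)).toReal + t * (g (u n)).toReal + dist (v n) (u n) ^ 2 / 2)
      (b := fun n => dist (y (n + 1)) (u n) ^ 2 + dist (x (n + 1 + 1)) (v (n + 1)) ^ 2)
      (fun n => by positivity) (fun n => by positivity)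
      (hyu.add ((summable_nat_add_iff 1).2 hxv)) (fun n => ?_) (fun n => ?_)
    · have h := hM (v n) (u n)
      rw [Phi, ← EReal.coe_toReal (hfv n) (hfbot _), ← EReal.coe_toReal (hgu n) (hgbot _)] at h
      norm_cast at h
      calc t * M ≤ t * ((f (v n)).toReal + (g (u n)).toReal
              + 1 / (2 * t) * dist (v n) (u n) ^ 2) := mul_le_mul_of_nonneg_left h ht.le
        _ = _ := by field_simp
    · have h₁ := prox_variational_inequality hcmp hfbot hfconv ht (hpv (n + 1)) (hfv n)
      have h₂ := prox_variational_inequality hcmp hgbot hgconv ht (hpu (n + 1)) (hgu n)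
      have h₃ := hadamard_quasilinearization_le hcmp (y (n + 1)) (u n) (v (n + 1)) (v n)
      have h₄ := hadamard_quasilinearization_le hcmp (x (n + 1 + 1)) (v (n + 1))
        (u (n + 1)) (u n)
      rw [dist_comm (u n) (v (n + 1)), dist_comm (u n) (v n)] at h₃
      linarith
  have hvs : Summable fun n => dist (v (n + 1)) (v n) ^ 2 :=
    Summable.of_nonneg_of_le (fun n => sq_nonneg _)
      (fun n => by linarith [sq_nonneg (dist (u (n + 1)) (u n))]) (hsum.mul_left 4)
  have hus : Summable fun n => dist (u (n + 1)) (u n) ^ 2 :=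
    Summable.of_nonneg_of_le (fun n => sq_nonneg _)
      (fun n => by linarith [sq_nonneg (dist (v (n + 1)) (v n))]) (hsum.mul_left 4)
  have hx := summable_step_sq_of_close (x := fun n => x (n + 1)) hxv hvs
  have hy := summable_step_sq_of_close (x := fun n => y (n + 1)) hyu hus
  exact ⟨(summable_nat_add_iff (f := fun n => dist (x (n + 1)) (x n) ^ 2) 1).1 hx,
    (summable_nat_add_iff (f := fun n => dist (y (n + 1)) (y n) ^ 2) 1).1 hy⟩
end

section
/- Under the backward-backward setup with summable errors, if the problem of minimizing Φ over X × X has a solution and at least one of the functions f, g is uniformly convex, then the solution (x̄, ȳ) is unique and (x_n, y_n) converges to (x̄, ȳ) with respect to the metric, i.e. x_n → x̄ and y_n → ȳ. -/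
open Set Filter Topology

/-- A function `h : X → ℝ ∪ {+∞}` is uniformly convex (w.r.t. the geodesics `G`) if there
is a modulus `φ : [0,∞) → [0,+∞]`, nondecreasing and vanishing exactly at `0`, with
`h(γ_{a,b}(λ)) ≤ (1−λ)h(a) + λh(b) − λ(1−λ)φ(d(a,b))`. -/
def UniformlyConvexOn {X : Type*} [MetricSpace X] (G : X → X → ℝ → X)
    (h : X → EReal) : Prop :=
  ∃ φ : ℝ → EReal,
    (∀ s u : ℝ, 0 ≤ s → s ≤ u → φ s ≤ φ u) ∧
    (∀ u ≥ (0:ℝ), 0 ≤ φ u) ∧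
    (∀ u ≥ (0:ℝ), (φ u = 0 ↔ u = 0)) ∧
    (∀ a b : X, ∀ l ∈ Icc (0:ℝ) 1,
      h (G a b l) + ((l * (1 - l) : ℝ) : EReal) * φ (dist a b)
        ≤ ((1 - l : ℝ) : EReal) * h a + ((l : ℝ) : EReal) * h b)

/-- `p` minimizes `z ↦ t h(z) + d(a,z)²/2`. -/
def IsProxPoint {X : Type*} [MetricSpace X] (t : ℝ) (h : X → EReal) (a p : X) : Prop :=
  ∀ z : X, ((t : ℝ) : EReal) * h p + (((1/2) * dist a p ^ 2 : ℝ) : EReal)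
    ≤ ((t : ℝ) : EReal) * h z + (((1/2) * dist a z ^ 2 : ℝ) : EReal)

/-- The convexity inequality of `h` along the geodesic from `a` to `b`, with gain `c`. -/
def ConvexAlong {X : Type*} (G : X → X → ℝ → X) (h : X → EReal) (c : ℝ) (a b : X) : Prop :=
  ∀ l ∈ Icc (0:ℝ) 1, h (G a b l) + ((l * (1 - l) * c : ℝ) : EReal)
    ≤ ((1 - l : ℝ) : EReal) * h a + ((l : ℝ) : EReal) * h b

theorem convexAlong_zero {X : Type*} {G : X → X → ℝ → X} {h : X → EReal}
    (hconv : ∀ a b : X, ∀ l ∈ Icc (0:ℝ) 1,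
      h (G a b l) ≤ ((1 - l : ℝ) : EReal) * h a + ((l : ℝ) : EReal) * h b) (a b : X) :
    ConvexAlong G h 0 a b := by
  intro l hl
  simpa using hconv a b l hl

theorem UniformlyConvexOn.exists_convexAlong {X : Type*} [MetricSpace X] {G : X → X → ℝ → X}
    {h : X → EReal} (hu : UniformlyConvexOn G h) {ε : ℝ} (hε : 0 < ε) :
    ∃ c : ℝ, 0 < c ∧ ∀ a b : X, ε ≤ dist a b → ConvexAlong G h c a b := by
  obtain ⟨φ, hmono, hnn, hzero, hconv⟩ := hu
  have hpos : 0 < φ ε :=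
    lt_of_le_of_ne (hnn ε hε.le) fun h0 => hε.ne' ((hzero ε hε.le).1 h0.symm)
  obtain ⟨c, hc0, hcφ⟩ := EReal.lt_iff_exists_real_btwn.1 hpos
  refine ⟨c, by exact_mod_cast hc0, fun a b hab l hl => le_trans ?_ (hconv a b l hl)⟩
  have hl' : (0 : EReal) ≤ ((l * (1 - l) : ℝ) : EReal) := by
    exact_mod_cast mul_nonneg hl.1 (by linarith [hl.2])
  rw [EReal.coe_mul (l * (1 - l)) c]
  exact add_le_add le_rfl
    (mul_le_mul_of_nonneg_left (hcφ.le.trans (hmono ε _ hε.le hab)) hl')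

theorem IsProxPoint.ne_top {X : Type*} [MetricSpace X] {t : ℝ} (ht : 0 < t) {h : X → EReal}
    (hproper : ∃ a, h a ≠ ⊤) (hbot : ∀ a, h a ≠ ⊥) {a p : X} (hp : IsProxPoint t h a p) :
    h p ≠ ⊤ := by
  obtain ⟨z, hz⟩ := hproper
  intro htop
  have h1 := hp z
  lift h z to ℝ using ⟨hz, hbot z⟩ with B
  rw [htop, EReal.coe_mul_top_of_pos ht, EReal.top_add_coe, top_le_iff] at h1
  exact EReal.coe_ne_top (t * B + (1/2) * dist a z ^ 2) (by exact_mod_cast h1)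

/-- The variational inequality of the proximal mapping. -/
theorem IsProxPoint.variational {X : Type*} [MetricSpace X] {G : X → X → ℝ → X}
    (hcmp : ∀ x y z : X, ∀ l ∈ Icc (0:ℝ) 1,
      dist z (G x y l) ^ 2 ≤ (1 - l) * dist z x ^ 2 + l * dist z y ^ 2
        - l * (1 - l) * dist x y ^ 2)
    {t : ℝ} (ht : 0 < t) {h : X → EReal} (hbot : ∀ a, h a ≠ ⊥) {a p z : X} {A B c : ℝ}
    (hA : h p = A) (hB : h z = B) (hp : IsProxPoint t h a p) (hc : ConvexAlong G h c p z) :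
    t * A + (1/2) * dist a p ^ 2 + ((1/2) * dist p z ^ 2 + t * c)
      ≤ t * B + (1/2) * dist a z ^ 2 := by
  have key : ∀ l ∈ Ioo (0:ℝ) 1, t * A + (1/2) * dist a p ^ 2
      + (1 - l) * ((1/2) * dist p z ^ 2 + t * c) ≤ t * B + (1/2) * dist a z ^ 2 := by
    intro l hl
    have hl' : l ∈ Icc (0:ℝ) 1 := ⟨hl.1.le, hl.2.le⟩
    have h1 := hc l hl'
    have h2 := hp (G p z l)
    have h3 := hcmp p z a l hl'
    rw [hA, hB] at h1
    rw [hA] at h2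
    have hw : h (G p z l) ≠ ⊤ := by
      intro htop
      rw [htop, EReal.top_add_coe, top_le_iff] at h1
      exact EReal.coe_ne_top ((1 - l) * A + l * B) (by exact_mod_cast h1)
    lift h (G p z l) to ℝ using ⟨hw, hbot _⟩ with C
    have h1' : C + l * (1 - l) * c ≤ (1 - l) * A + l * B := by exact_mod_cast h1
    have h2' : t * C + (1/2) * dist a (G p z l) ^ 2 ≥ t * A + (1/2) * dist a p ^ 2 := by
      exact_mod_cast h2
    have h4 := mul_le_mul_of_nonneg_left h1' ht.le
    have h5 : l * (t * A + (1/2) * dist a p ^ 2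
        + (1 - l) * ((1/2) * dist p z ^ 2 + t * c)) ≤ l * (t * B + (1/2) * dist a z ^ 2) := by
      linarith
    exact le_of_mul_le_mul_left h5 hl.1
  have hlim : Tendsto (fun l : ℝ => t * A + (1/2) * dist a p ^ 2
      + (1 - l) * ((1/2) * dist p z ^ 2 + t * c)) (𝓝[>] 0)
      (𝓝 (t * A + (1/2) * dist a p ^ 2 + (1 - 0) * ((1/2) * dist p z ^ 2 + t * c))) :=
    (Continuous.tendsto (by fun_prop) 0).mono_left nhdsWithin_le_nhds
  rw [sub_zero, one_mul] at hlim
  refine le_of_tendsto hlim ?_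
  filter_upwards [Ioo_mem_nhdsGT (zero_lt_one' ℝ)] with l hl using key l hl

/-- Reshetnyak's quadrilateral inequality. -/
theorem quadrilateral_inequality {X : Type*} [MetricSpace X] {G : X → X → ℝ → X}
    (hcmp : ∀ x y z : X, ∀ l ∈ Icc (0:ℝ) 1,
      dist z (G x y l) ^ 2 ≤ (1 - l) * dist z x ^ 2 + l * dist z y ^ 2
        - l * (1 - l) * dist x y ^ 2) (a b c d : X) :
    dist a c ^ 2 + dist b d ^ 2
      ≤ dist b c ^ 2 + dist a d ^ 2 + 2 * (dist a b * dist c d) := by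
  rcases eq_or_ne a b with rfl | hab
  · simp
  rcases eq_or_ne c d with rfl | hcd
  · simp [add_comm]
  have hP : 0 < dist a b := dist_pos.2 hab
  have hQ : 0 < dist c d := dist_pos.2 hcd
  set P := dist a b
  set Q := dist c d
  have hPQ : 0 < P + Q := add_pos hP hQ
  have hl : P / (P + Q) ∈ Icc (0:ℝ) 1 :=
    ⟨by positivity, (div_le_one hPQ).2 (by linarith)⟩
  have h1 := hcmp a c b _ hl
  have h2 := hcmp a c d _ hl
  have h3 := dist_triangle_right b d (G a c (P / (P + Q)))
  set U := dist b (G a c (P / (P + Q)))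
  set V := dist d (G a c (P / (P + Q)))
  rw [dist_comm b a] at h1
  rw [dist_comm d a, dist_comm d c] at h2
  change U ^ 2 ≤ (1 - P / (P + Q)) * P ^ 2 + P / (P + Q) * dist b c ^ 2
    - P / (P + Q) * (1 - P / (P + Q)) * dist a c ^ 2 at h1
  change V ^ 2 ≤ (1 - P / (P + Q)) * dist a d ^ 2 + P / (P + Q) * Q ^ 2
    - P / (P + Q) * (1 - P / (P + Q)) * dist a c ^ 2 at h2
  have e : 1 - P / (P + Q) = Q / (P + Q) := by field_simp; ring
  rw [e] at h1 h2
  have h1' : U ^ 2 * (P + Q) / P ≤ Q * P + dist b c ^ 2 - Q / (P + Q) * dist a c ^ 2 := by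
    calc U ^ 2 * (P + Q) / P = U ^ 2 * ((P + Q) / P) := by ring
      _ ≤ _ := mul_le_mul_of_nonneg_right h1 (by positivity)
      _ = _ := by field_simp
  have h2' : V ^ 2 * (P + Q) / Q ≤ dist a d ^ 2 + P * Q - P / (P + Q) * dist a c ^ 2 := by
    calc V ^ 2 * (P + Q) / Q = V ^ 2 * ((P + Q) / Q) := by ring
      _ ≤ _ := mul_le_mul_of_nonneg_right h2 (by positivity)
      _ = _ := by field_simp
  have h4 : dist b d ^ 2 ≤ (U + V) ^ 2 := pow_le_pow_left₀ dist_nonneg h3 2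
  have h5 : (U + V) ^ 2 ≤ U ^ 2 * (P + Q) / P + V ^ 2 * (P + Q) / Q := by
    have : U ^ 2 * (P + Q) / P + V ^ 2 * (P + Q) / Q - (U + V) ^ 2
        = (U * Q - V * P) ^ 2 / (P * Q) := by field_simp; ring
    have : 0 ≤ (U * Q - V * P) ^ 2 / (P * Q) := by positivity
    linarith
  have h6 : Q / (P + Q) * dist a c ^ 2 + P / (P + Q) * dist a c ^ 2 = dist a c ^ 2 := by
    field_simp; ring
  linarith

/-- Firm nonexpansiveness of the proximal mapping, with a gain coming from convexity. -/
theorem IsProxPoint.dist_sq_add_le {X : Type*} [MetricSpace X] {G : X → X → ℝ → X}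
    (hcmp : ∀ x y z : X, ∀ l ∈ Icc (0:ℝ) 1,
      dist z (G x y l) ^ 2 ≤ (1 - l) * dist z x ^ 2 + l * dist z y ^ 2
        - l * (1 - l) * dist x y ^ 2)
    {t : ℝ} (ht : 0 < t) {h : X → EReal} (hproper : ∃ a, h a ≠ ⊤) (hbot : ∀ a, h a ≠ ⊥)
    {a b p q : X} {c : ℝ} (hp : IsProxPoint t h a p) (hq : IsProxPoint t h b q)
    (hpq : ConvexAlong G h c p q) (hqp : ConvexAlong G h c q p) :
    dist p q ^ 2 + 2 * t * c ≤ dist a b * dist p q := by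
  have hA := EReal.coe_toReal (hp.ne_top ht hproper hbot) (hbot p)
  have hB := EReal.coe_toReal (hq.ne_top ht hproper hbot) (hbot q)
  have h1 := hp.variational hcmp ht hbot hA.symm hB.symm hpq
  have h2 := hq.variational hcmp ht hbot hB.symm hA.symm hqp
  have h3 := quadrilateral_inequality hcmp a b q p
  rw [dist_comm q p] at h2 h3
  linarith

theorem IsProxPoint.dist_le {X : Type*} [MetricSpace X] {G : X → X → ℝ → X}
    (hcmp : ∀ x y z : X, ∀ l ∈ Icc (0:ℝ) 1,
      dist z (G x y l) ^ 2 ≤ (1 - l) * dist z x ^ 2 + l * dist z y ^ 2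
        - l * (1 - l) * dist x y ^ 2)
    {t : ℝ} (ht : 0 < t) {h : X → EReal} (hproper : ∃ a, h a ≠ ⊤) (hbot : ∀ a, h a ≠ ⊥)
    (hconv : ∀ a b : X, ∀ l ∈ Icc (0:ℝ) 1,
      h (G a b l) ≤ ((1 - l : ℝ) : EReal) * h a + ((l : ℝ) : EReal) * h b)
    {a b p q : X} (hp : IsProxPoint t h a p) (hq : IsProxPoint t h b q) :
    dist p q ≤ dist a b := by
  have h1 := hp.dist_sq_add_le hcmp ht hproper hbot hq
    (convexAlong_zero hconv p q) (convexAlong_zero hconv q p)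
  by_contra! hlt
  have h2 : 0 ≤ dist a b := dist_nonneg
  nlinarith

theorem IsProxPoint.exists_gain {X : Type*} [MetricSpace X] {G : X → X → ℝ → X}
    (hcmp : ∀ x y z : X, ∀ l ∈ Icc (0:ℝ) 1,
      dist z (G x y l) ^ 2 ≤ (1 - l) * dist z x ^ 2 + l * dist z y ^ 2
        - l * (1 - l) * dist x y ^ 2)
    {t : ℝ} (ht : 0 < t) {h : X → EReal} (hproper : ∃ a, h a ≠ ⊤) (hbot : ∀ a, h a ≠ ⊥)
    (hu : UniformlyConvexOn G h) {ε : ℝ} (hε : 0 < ε) :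
    ∃ δ : ℝ, 0 < δ ∧ ∀ a b p q : X, IsProxPoint t h a p → IsProxPoint t h b q →
      ε ≤ dist p q → dist p q ^ 2 + δ ≤ dist a b * dist p q := by
  obtain ⟨c, hc, hcv⟩ := hu.exists_convexAlong hε
  refine ⟨2 * t * c, by positivity, fun a b p q hp hq hpq => ?_⟩
  exact hp.dist_sq_add_le hcmp ht hproper hbot hq (hcv p q hpq)
    (hcv q p (by rwa [dist_comm]))

theorem exists_tendsto_of_le_add_summable {a e : ℕ → ℝ} (ha : ∀ n, 0 ≤ a n)
    (he : Summable e) (h : ∀ n, a (n + 1) ≤ a n + e n) : ∃ A, Tendsto a atTop (𝓝 A) := by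
  have hs := he.hasSum.tendsto_sum_nat
  have hanti : Antitone fun n => a n - ∑ i ∈ Finset.range n, e i := by
    refine antitone_nat_of_succ_le fun n => ?_
    rw [Finset.sum_range_succ]
    linarith [h n]
  obtain ⟨M, hM⟩ := hs.bddAbove_range
  have hbdd : BddBelow (range fun n => a n - ∑ i ∈ Finset.range n, e i) := by
    refine ⟨-M, ?_⟩
    rintro _ ⟨n, rfl⟩
    have := hM ⟨n, rfl⟩
    dsimp only at this ⊢
    linarith [ha n]
  refine ⟨_, ((tendsto_atTop_ciInf hanti hbdd).add hs).congr fun n => ?_⟩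
  ring

theorem eq_zero_of_tendsto_of_gain {u v : ℕ → ℝ} {A : ℝ} (hv : ∀ n, 0 ≤ v n)
    (hu_lim : Tendsto u atTop (𝓝 A)) (hv_lim : Tendsto v atTop (𝓝 A))
    (hgain : ∀ ε : ℝ, 0 < ε → ∃ δ : ℝ, 0 < δ ∧ ∀ n, ε ≤ v n → v n ^ 2 + δ ≤ u n * v n) :
    A = 0 := by
  have hA : 0 ≤ A := ge_of_tendsto' hv_lim hv
  by_contra hne
  have hpos : 0 < A := lt_of_le_of_ne hA (Ne.symm hne)
  obtain ⟨δ, hδ, hd⟩ := hgain (A / 2) (by linarith)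
  have hev : ∀ᶠ n in atTop, v n ^ 2 + δ ≤ u n * v n := by
    filter_upwards [hv_lim.eventually_const_le (by linarith : A / 2 < A)] with n hn
    exact hd n hn
  have := le_of_tendsto_of_tendsto ((hv_lim.pow 2).add_const δ) (hu_lim.mul hv_lim) hev
  nlinarith

/-- Distances to the limit along an alternating scheme of two nonexpansive steps with summable
errors, one of which is strictly contracting away from zero. -/
theorem tendsto_zero_of_alternating {a b p q ε δ : ℕ → ℝ} (ha : ∀ n, 0 ≤ a n)
    (hp : ∀ n, 0 ≤ p n) (hq : ∀ n, 0 ≤ q n) (hε : Summable ε) (hδ : Summable δ)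
    (hpa : ∀ n, p n ≤ a n) (hbp : ∀ n, b n ≤ p n + ε n) (hqb : ∀ n, q n ≤ b n)
    (haq : ∀ n, a (n + 1) ≤ q n + δ n)
    (hgain : (∀ r : ℝ, 0 < r → ∃ s : ℝ, 0 < s ∧ ∀ n, r ≤ q n → q n ^ 2 + s ≤ b n * q n) ∨
      (∀ r : ℝ, 0 < r → ∃ s : ℝ, 0 < s ∧ ∀ n, r ≤ p n → p n ^ 2 + s ≤ a n * p n)) :
    Tendsto a atTop (𝓝 0) ∧ Tendsto b atTop (𝓝 0) := by
  obtain ⟨A, hA⟩ := exists_tendsto_of_le_add_summable ha (hε.add hδ) fun n => by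
    linarith [hpa n, hbp n, hqb n, haq n]
  have hA' := hA.comp (tendsto_add_atTop_nat 1)
  have hε0 := hε.tendsto_atTop_zero
  have hδ0 := hδ.tendsto_atTop_zero
  have hlow : Tendsto (fun n => a (n + 1) - δ n) atTop (𝓝 A) := by
    simpa using hA'.sub hδ0
  have hup : Tendsto (fun n => a n + ε n) atTop (𝓝 A) := by
    simpa using hA.add hε0
  have hlow' : Tendsto (fun n => a (n + 1) - δ n - ε n) atTop (𝓝 A) := by
    simpa using hlow.sub hε0
  have hq_lim : Tendsto q atTop (𝓝 A) := tendsto_of_tendsto_of_tendsto_of_le_of_le hlow hup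
    (fun n => by dsimp only; linarith [haq n])
    (fun n => by dsimp only; linarith [hpa n, hbp n, hqb n])
  have hb_lim : Tendsto b atTop (𝓝 A) := tendsto_of_tendsto_of_tendsto_of_le_of_le hlow hup
    (fun n => by dsimp only; linarith [haq n, hqb n])
    (fun n => by dsimp only; linarith [hpa n, hbp n])
  have hp_lim : Tendsto p atTop (𝓝 A) := tendsto_of_tendsto_of_tendsto_of_le_of_le hlow' hA
    (fun n => by dsimp only; linarith [haq n, hqb n, hbp n]) hpa
  have hA0 : A = 0 := hgain.elim (eq_zero_of_tendsto_of_gain hq hb_lim hq_lim)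
    (eq_zero_of_tendsto_of_gain hp hA hp_lim)
  exact hA0 ▸ ⟨hA, hb_lim⟩

theorem Phi_comm {X : Type*} [MetricSpace X] (f g : X → EReal) (t : ℝ) (x y : X) :
    Phi f g t x y = Phi g f t y x := by
  simp only [Phi, add_comm (f x), dist_comm x y]

theorem isProxPoint_of_Phi_le {X : Type*} [MetricSpace X] {f g : X → EReal} {t : ℝ}
    (ht : 0 < t) (hfproper : ∃ a, f a ≠ ⊤) (hfbot : ∀ a, f a ≠ ⊥)
    (hgproper : ∃ a, g a ≠ ⊤) (hgbot : ∀ a, g a ≠ ⊥) {u v : X}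
    (hmin : ∀ a b : X, Phi f g t u v ≤ Phi f g t a b) : IsProxPoint t f v u := by
  obtain ⟨a₀, ha₀⟩ := hfproper
  obtain ⟨b₀, hb₀⟩ := hgproper
  have hfin : Phi f g t u v ≠ ⊤ := by
    refine ne_top_of_le_ne_top ?_ (hmin a₀ b₀)
    exact EReal.add_ne_top (EReal.add_ne_top ha₀ hb₀) (EReal.coe_ne_top _)
  have hfu : f u ≠ ⊤ := by
    intro h
    apply hfin
    rw [Phi, h, EReal.top_add_of_ne_bot (hgbot v), EReal.top_add_coe]
  have hgv : g v ≠ ⊤ := by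
    intro h
    apply hfin
    rw [Phi, h, EReal.add_top_of_ne_bot (hfbot u), EReal.top_add_coe]
  intro z
  by_cases hz : f z = ⊤
  · rw [hz, EReal.coe_mul_top_of_pos ht, EReal.top_add_coe]
    exact le_top
  have h1 := hmin z v
  simp only [Phi] at h1
  lift f u to ℝ using ⟨hfu, hfbot u⟩ with A
  lift f z to ℝ using ⟨hz, hfbot z⟩ with B
  lift g v to ℝ using ⟨hgv, hgbot v⟩ with C
  have h2 : A + C + (1 / (2 * t)) * dist u v ^ 2 ≤ B + C + (1 / (2 * t)) * dist z v ^ 2 := by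
    exact_mod_cast h1
  have h3 := mul_le_mul_of_nonneg_left h2 ht.le
  have e : ∀ D E : ℝ, t * (D + C + (1 / (2 * t)) * E) = t * D + t * C + (1/2) * E := by
    intro D E
    field_simp
  rw [e, e, dist_comm u v, dist_comm z v] at h3
  have h4 : t * A + (1/2) * dist v u ^ 2 ≤ t * B + (1/2) * dist v z ^ 2 := by linarith
  exact_mod_cast h4

/-- Alternating proximal steps with summable errors converge to any pair of mutual proximal
points, provided one of the functions is uniformly convex. -/
theorem tendsto_of_alternating_prox {X : Type*} [MetricSpace X] {G : X → X → ℝ → X}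
    (hcmp : ∀ x y z : X, ∀ l ∈ Icc (0:ℝ) 1,
      dist z (G x y l) ^ 2 ≤ (1 - l) * dist z x ^ 2 + l * dist z y ^ 2
        - l * (1 - l) * dist x y ^ 2)
    {f g : X → EReal} (hfproper : ∃ a, f a ≠ ⊤) (hfbot : ∀ a, f a ≠ ⊥)
    (hfconv : ∀ a b : X, ∀ l ∈ Icc (0:ℝ) 1,
      f (G a b l) ≤ ((1 - l : ℝ) : EReal) * f a + ((l : ℝ) : EReal) * f b)
    (hgproper : ∃ a, g a ≠ ⊤) (hgbot : ∀ a, g a ≠ ⊥)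
    (hgconv : ∀ a b : X, ∀ l ∈ Icc (0:ℝ) 1,
      g (G a b l) ≤ ((1 - l : ℝ) : EReal) * g a + ((l : ℝ) : EReal) * g b)
    {t : ℝ} (ht : 0 < t) (huconv : UniformlyConvexOn G f ∨ UniformlyConvexOn G g)
    {x y u v : ℕ → X} (hu : ∀ n, IsProxPoint t f (y n) (u n))
    (hv : ∀ n, IsProxPoint t g (x n) (v n))
    (herr₁ : Summable fun n => dist (y n) (v n))
    (herr₂ : Summable fun n => dist (x (n + 1)) (u n)) {xs ys : X}
    (hxs : IsProxPoint t f ys xs) (hys : IsProxPoint t g xs ys) :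
    Tendsto x atTop (𝓝 xs) ∧ Tendsto y atTop (𝓝 ys) := by
  rw [tendsto_iff_dist_tendsto_zero (f := x), tendsto_iff_dist_tendsto_zero (f := y)]
  refine tendsto_zero_of_alternating (p := fun n => dist (v n) ys) (q := fun n => dist (u n) xs)
    (fun n => dist_nonneg) (fun n => dist_nonneg) (fun n => dist_nonneg) herr₁ herr₂
    (fun n => (hv n).dist_le hcmp ht hgproper hgbot hgconv hys)
    (fun n => (dist_triangle (y n) (v n) ys).trans_eq (add_comm _ _))
    (fun n => (hu n).dist_le hcmp ht hfproper hfbot hfconv hxs)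
    (fun n => (dist_triangle (x (n + 1)) (u n) xs).trans_eq (add_comm _ _)) ?_
  refine huconv.imp (fun h r hr => ?_) (fun h r hr => ?_)
  · obtain ⟨s, hs, hgain⟩ := IsProxPoint.exists_gain hcmp ht hfproper hfbot h hr
    exact ⟨s, hs, fun n => hgain _ _ _ _ (hu n) hxs⟩
  · obtain ⟨s, hs, hgain⟩ := IsProxPoint.exists_gain hcmp ht hgproper hgbot h hr
    exact ⟨s, hs, fun n => hgain _ _ _ _ (hv n) hys⟩

/-- Backward-backward setup with summable errors: if `Φ` has a
minimizer over `X × X` and one of `f`, `g` is uniformly convex, then the minimizer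
`(x̄, ȳ)` is unique and `x_n → x̄`, `y_n → ȳ` in the metric. -/
theorem bb_strong_convergence
    {X : Type*} [MetricSpace X] [CompleteSpace X]
    (G : X → X → ℝ → X)
    (hG0 : ∀ x y, G x y 0 = x) (hG1 : ∀ x y, G x y 1 = y)
    (hGd : ∀ x y, ∀ s ∈ Icc (0:ℝ) 1, ∀ u ∈ Icc (0:ℝ) 1,
      dist (G x y s) (G x y u) = |s - u| * dist x y)
    (hcmp : ∀ x y z : X, ∀ l ∈ Icc (0:ℝ) 1,
      dist z (G x y l) ^ 2 ≤ (1 - l) * dist z x ^ 2 + l * dist z y ^ 2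
        - l * (1 - l) * dist x y ^ 2)
    (f g : X → EReal)
    (hfproper : ∃ a, f a ≠ ⊤) (hfbot : ∀ a, f a ≠ ⊥)
    (hfconv : ∀ a b : X, ∀ l ∈ Icc (0:ℝ) 1,
      f (G a b l) ≤ ((1 - l : ℝ) : EReal) * f a + ((l : ℝ) : EReal) * f b)
    (hflsc : LowerSemicontinuous f)
    (hgproper : ∃ a, g a ≠ ⊤) (hgbot : ∀ a, g a ≠ ⊥)
    (hgconv : ∀ a b : X, ∀ l ∈ Icc (0:ℝ) 1,
      g (G a b l) ≤ ((1 - l : ℝ) : EReal) * g a + ((l : ℝ) : EReal) * g b)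
    (hglsc : LowerSemicontinuous g)
    (t : ℝ) (ht : 0 < t)
    -- `proxf x = Prox_{t·f}(x)` and `proxg x = Prox_{t·g}(x)`:
    (proxf proxg : X → X)
    (hproxf : ∀ a z : X,
      ((t : ℝ) : EReal) * f (proxf a) + (((1/2) * dist a (proxf a) ^ 2 : ℝ) : EReal)
        ≤ ((t : ℝ) : EReal) * f z + (((1/2) * dist a z ^ 2 : ℝ) : EReal))
    (hproxg : ∀ a z : X,
      ((t : ℝ) : EReal) * g (proxg a) + (((1/2) * dist a (proxg a) ^ 2 : ℝ) : EReal)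
        ≤ ((t : ℝ) : EReal) * g z + (((1/2) * dist a z ^ 2 : ℝ) : EReal))
    (x y : ℕ → X)
    (herr₁ : Summable (fun n => dist (y n) (proxg (x n))))
    (herr₂ : Summable (fun n => dist (x (n + 1)) (proxf (y n))))
    (hsol : ∃ p : X × X, ∀ a b : X, Phi f g t p.1 p.2 ≤ Phi f g t a b)
    (huconv : UniformlyConvexOn G f ∨ UniformlyConvexOn G g) :
    ∃ p : X × X, (∀ a b : X, Phi f g t p.1 p.2 ≤ Phi f g t a b) ∧
      (∀ q : X × X, (∀ a b : X, Phi f g t q.1 q.2 ≤ Phi f g t a b) → q = p) ∧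
      Tendsto x atTop (nhds p.1) ∧ Tendsto y atTop (nhds p.2) := by
  obtain ⟨p, hp⟩ := hsol
  have hfprox : ∀ q : X × X, (∀ a b : X, Phi f g t q.1 q.2 ≤ Phi f g t a b) →
      IsProxPoint t f q.2 q.1 := fun q hq =>
    isProxPoint_of_Phi_le ht hfproper hfbot hgproper hgbot hq
  have hgprox : ∀ q : X × X, (∀ a b : X, Phi f g t q.1 q.2 ≤ Phi f g t a b) →
      IsProxPoint t g q.1 q.2 := fun q hq =>
    isProxPoint_of_Phi_le ht hgproper hgbot hfproper hfbot fun b a => by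
      rw [← Phi_comm, ← Phi_comm f g t a b]
      exact hq a b
  refine ⟨p, hp, fun q hq => ?_, ?_⟩
  · obtain ⟨h1, h2⟩ := tendsto_of_alternating_prox hcmp hfproper hfbot hfconv hgproper hgbot
      hgconv ht huconv (x := fun _ => q.1) (y := fun _ => q.2) (fun _ => hfprox q hq)
      (fun _ => hgprox q hq) (by simp [summable_zero]) (by simp [summable_zero])
      (hfprox p hp) (hgprox p hp)
    exact Prod.ext (tendsto_nhds_unique tendsto_const_nhds h1)
      (tendsto_nhds_unique tendsto_const_nhds h2)
  · exact tendsto_of_alternating_prox hcmp hfproper hfbot hfconv hgproper hgbot hgconv ht huconv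
      (fun n => hproxf (y n)) (fun n => hproxg (x n)) herr₁ herr₂ (hfprox p hp) (hgprox p hp)
end
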